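/- For every T > 0, M ≥ 1 and ε ∈ (0,1] there exists a constant C > 0, depending only on M, ε and T, such that every smooth solution (v,u,θ,q) of the radiation hydrodynamics system on [0,T] with (M,ε)-bounded initial data satisfies, for all t ∈ [0,T]: ‖u_x(t,·)‖ ≤ C(1 + 𝔜(t)^{1/(4β+6)}) ℨ(t)^{1/4} and ‖u_x(t,·)‖_{L^∞} ≤ C(1 + 𝔜(t)^{3/(8β+12)}) ℨ(t)^{3/8}. -/

import Mathlib

open MeasureTheory Real Set

noncomputable section

namespace RadHydro

/-- Integral over one period `[-1/2, 1/2]` of the torus `𝕋 ≅ ℝ/ℤ`. -/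
def tInt (f : ℝ → ℝ) : ℝ := ∫ x in (-(1/2) : ℝ)..(1/2 : ℝ), f x

/-- Squared `L²` norm over the torus. -/
def L2sq (f : ℝ → ℝ) : ℝ := tInt fun x => (f x) ^ 2

/-- `L^∞` norm over the torus. -/
def Linf (f : ℝ → ℝ) : ℝ := sSup ((fun x => |f x|) '' Icc (-(1/2) : ℝ) (1/2))

/-- Squared `H¹` norm over the torus. -/
def H1sq (f : ℝ → ℝ) : ℝ := L2sq f + L2sq (deriv f)

/-- Squared `H²` norm over the torus. -/
def H2sq (f : ℝ → ℝ) : ℝ := L2sq f + L2sq (deriv f) + L2sq (deriv (deriv f))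

/-- Partial derivative in the time variable. -/
def pt (f : ℝ → ℝ → ℝ) (t x : ℝ) : ℝ := deriv (fun s => f s x) t

/-- Partial derivative in the space variable. -/
def px (f : ℝ → ℝ → ℝ) (t x : ℝ) : ℝ := deriv (f t) x

/-- The heat conductivity `κ(v, θ) = κ₁ + κ₂ v θ^β`. -/
def kappa (κ₁ κ₂ β v θ : ℝ) : ℝ := κ₁ + κ₂ * v * θ ^ β

/-- A smooth solution of the radiation hydrodynamics system (in Lagrangian
coordinates) on `[0, T]`: four `C^∞` functions on `[0,T] × ℝ` (modelled as smooth
functions on all of `ℝ × ℝ`), `1`-periodic in the space variable, with `v > 0`,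
`θ > 0`, satisfying the four equations pointwise for `t ∈ [0, T]`, and with the
normalization `∫_𝕋 v(0, x) dx = 1`. -/
structure Sol (μ R a b κ₁ κ₂ β γ T : ℝ) where
  v : ℝ → ℝ → ℝ
  u : ℝ → ℝ → ℝ
  θ : ℝ → ℝ → ℝ
  q : ℝ → ℝ → ℝ
  smooth_v : ContDiff ℝ (⊤ : ℕ∞) fun p : ℝ × ℝ => v p.1 p.2
  smooth_u : ContDiff ℝ (⊤ : ℕ∞) fun p : ℝ × ℝ => u p.1 p.2
  smooth_θ : ContDiff ℝ (⊤ : ℕ∞) fun p : ℝ × ℝ => θ p.1 p.2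
  smooth_q : ContDiff ℝ (⊤ : ℕ∞) fun p : ℝ × ℝ => q p.1 p.2
  periodic_v : ∀ t, Function.Periodic (v t) 1
  periodic_u : ∀ t, Function.Periodic (u t) 1
  periodic_θ : ∀ t, Function.Periodic (θ t) 1
  periodic_q : ∀ t, Function.Periodic (q t) 1
  v_pos : ∀ t x, 0 < v t x
  θ_pos : ∀ t x, 0 < θ t x
  eq_mass : ∀ t ∈ Icc (0 : ℝ) T, ∀ x : ℝ, pt v t x - px u t x = 0
  eq_mom : ∀ t ∈ Icc (0 : ℝ) T, ∀ x : ℝ,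
    pt u t x + px (fun s y => R * θ s y / v s y) t x
      = px (fun s y => μ * px u s y / v s y) t x
  eq_energy : ∀ t ∈ Icc (0 : ℝ) T, ∀ x : ℝ,
    pt (fun s y => R / (γ - 1) * θ s y + (u s y) ^ 2 / 2) t x
      + px (fun s y => R * θ s y / v s y * u s y) t x + px q t x
      = px (fun s y => μ * u s y * px u s y / v s y) t x
        + px (fun s y => kappa κ₁ κ₂ β (v s y) (θ s y) * px θ s y / v s y) t x
  eq_rad : ∀ t ∈ Icc (0 : ℝ) T, ∀ x : ℝ,
    -px (fun s y => px q s y / v s y) t x + a * v t x * q t x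
      + b * px (fun s y => (θ s y) ^ 4) t x = 0
  mean_v : tInt (v 0) = 1

/-- `(M, ε)`-bounded initial data: `‖(v₀, u₀, θ₀)‖_{H²} ≤ M` and `v₀ ≥ ε`, `θ₀ ≥ ε`. -/
def DataBounded (M ε : ℝ) (v₀ u₀ θ₀ : ℝ → ℝ) : Prop :=
  Real.sqrt (H2sq v₀ + H2sq u₀ + H2sq θ₀) ≤ M ∧ (∀ x, ε ≤ v₀ x) ∧ ∀ x, ε ≤ θ₀ x

variable {μ R a b κ₁ κ₂ β γ T : ℝ}

/-- A solution has `(M, ε)`-bounded initial data. -/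
def Sol.Bounded (S : Sol μ R a b κ₁ κ₂ β γ T) (M ε : ℝ) : Prop :=
  DataBounded M ε (S.v 0) (S.u 0) (S.θ 0)

/-- The auxiliary function `𝔛(t) = ∫₀ᵗ ∫_𝕋 κ(v,θ) θ_t² / v dx ds`. -/
def Sol.X (S : Sol μ R a b κ₁ κ₂ β γ T) (t : ℝ) : ℝ :=
  ∫ s in (0 : ℝ)..t, tInt fun x =>
    kappa κ₁ κ₂ β (S.v s x) (S.θ s x) * (pt S.θ s x) ^ 2 / S.v s x

/-- The auxiliary function `𝔜(t) = max_{0 ≤ s ≤ t} ∫_𝕋 κ(v,θ)² θ_x² / v² dx`. -/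
def Sol.Y (S : Sol μ R a b κ₁ κ₂ β γ T) (t : ℝ) : ℝ :=
  sSup ((fun s => tInt fun x =>
    (kappa κ₁ κ₂ β (S.v s x) (S.θ s x)) ^ 2 * (px S.θ s x) ^ 2 / (S.v s x) ^ 2) ''
      Icc (0 : ℝ) t)

/-- The auxiliary function `ℨ(t) = max_{0 ≤ s ≤ t} ∫_𝕋 u_{xx}² / v² dx`. -/
def Sol.Z (S : Sol μ R a b κ₁ κ₂ β γ T) (t : ℝ) : ℝ :=
  sSup ((fun s => tInt fun x => (px (px S.u) s x) ^ 2 / (S.v s x) ^ 2) '' Icc (0 : ℝ) t)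

/-- The exponent `𝔗₀(n, p, β)`. -/
def T0 (n _p β : ℝ) : ℝ :=
  if n < (β + 3) / 2 then 4 / (n * (2 * β + 3)) else (n - β + 5) / (n * (2 * β + 3))

/-- The exponent `𝔗₁(n, β)`. -/
def T1 (n β : ℝ) : ℝ := max (T0 n 8 β) (1 / (2 * β + 3) + T0 n 1 β)

/-- The exponent `𝔘ʸ₁₁(n, β)`. -/
def Uy11 (n β : ℝ) : ℝ := 2 / (2 * β + 3) + T0 n 1 β

/-- The exponent `𝔘ᶻ₁₁(n, β)`. -/
def Uz11 (n β : ℝ) : ℝ := 3 / 4 * (1 / (1 - T0 n (5/2) β))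

/-- The exponent `𝔘ʸ₂(n, β)`. -/
def Uy2 (n β : ℝ) : ℝ := 2 / (2 * β + 3) + T1 n β

/-- The exponent `𝔘ᶻ₂(n, β)`. -/
def Uz2 (n β : ℝ) : ℝ := 3 / 4 * (1 / (1 - T0 n (3/2) β - T1 n β))

end RadHydro

open RadHydro

namespace RadHydro

/-- A function of time and space is jointly `C^∞`. -/
abbrev JointSmooth (f : ℝ → ℝ → ℝ) : Prop :=
  ContDiff ℝ (⊤ : ℕ∞) fun p : ℝ × ℝ => f p.1 p.2

namespace JointSmooth

variable {f : ℝ → ℝ → ℝ}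

lemma hasDerivAt_px (hf : JointSmooth f) (t x : ℝ) : HasDerivAt (f t) (px f t x) x := by
  have h : ContDiff ℝ (⊤ : ℕ∞) (f t) :=
    ContDiff.comp (g := fun p : ℝ × ℝ => f p.1 p.2) hf (contDiff_const.prodMk contDiff_id)
  exact (h.differentiable (by simp) x).hasDerivAt

lemma hasDerivAt_pt (hf : JointSmooth f) (t x : ℝ) :
    HasDerivAt (fun s => f s x) (pt f t x) t := by
  have h : ContDiff ℝ (⊤ : ℕ∞) (fun s => f s x) :=
    ContDiff.comp (g := fun p : ℝ × ℝ => f p.1 p.2) hf (contDiff_id.prodMk contDiff_const)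
  exact (h.differentiable (by simp) t).hasDerivAt

lemma contDiff_fderiv_apply (hf : JointSmooth f) (w : ℝ × ℝ) :
    ContDiff ℝ (⊤ : ℕ∞) fun p => fderiv ℝ (fun p : ℝ × ℝ => f p.1 p.2) p w :=
  (ContDiff.fderiv_right (m := ((⊤ : ℕ∞) : WithTop ℕ∞)) hf (by simp)).clm_apply contDiff_const

lemma px (hf : JointSmooth f) : JointSmooth (px f) := by
  have h : (fun p : ℝ × ℝ => RadHydro.px f p.1 p.2) =
      fun p => fderiv ℝ (fun p : ℝ × ℝ => f p.1 p.2) p (0, 1) := by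
    funext p
    have h1 := (hf.differentiable (by simp) p).hasFDerivAt
    have h2 : HasDerivAt (fun y : ℝ => (p.1, y)) ((0 : ℝ), (1 : ℝ)) p.2 :=
      (hasDerivAt_const _ _).prodMk (hasDerivAt_id _)
    exact (hf.hasDerivAt_px p.1 p.2).unique
      (h1.comp_hasDerivAt (f := fun y : ℝ => (p.1, y)) p.2 h2)
  rw [JointSmooth, h]
  exact hf.contDiff_fderiv_apply (0, 1)

lemma pt (hf : JointSmooth f) : JointSmooth (pt f) := by
  have h : (fun p : ℝ × ℝ => RadHydro.pt f p.1 p.2) =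
      fun p => fderiv ℝ (fun p : ℝ × ℝ => f p.1 p.2) p (1, 0) := by
    funext p
    have h1 := (hf.differentiable (by simp) p).hasFDerivAt
    have h2 : HasDerivAt (fun s : ℝ => (s, p.2)) ((1 : ℝ), (0 : ℝ)) p.1 :=
      (hasDerivAt_id _).prodMk (hasDerivAt_const _ _)
    exact (hf.hasDerivAt_pt p.1 p.2).unique
      (h1.comp_hasDerivAt (f := fun s : ℝ => (s, p.2)) p.1 h2)
  rw [JointSmooth, h]
  exact hf.contDiff_fderiv_apply (1, 0)

lemma continuous_slice (hf : JointSmooth f) (t : ℝ) : Continuous (f t) :=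
  hf.continuous.comp (Continuous.prodMk_right t)

end JointSmooth

lemma periodic_px {f : ℝ → ℝ → ℝ} (hf : ∀ t, Function.Periodic (f t) 1) (t : ℝ) :
    Function.Periodic (px f t) 1 := by
  intro x
  have h : (fun y => f t (y + 1)) = f t := funext (hf t)
  calc px f t (x + 1) = deriv (fun y => f t (y + 1)) x := (deriv_comp_add_const _ _ _).symm
    _ = px f t x := by rw [h]; rfl

lemma periodic_endpoints {f : ℝ → ℝ} (hf : Function.Periodic f 1) : f (1/2) = f (-(1/2)) := by
  rw [← hf (-(1/2))]; norm_num

/-! ### Integrals over one period -/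

lemma tInt_mono {f g : ℝ → ℝ} (hf : Continuous f) (hg : Continuous g)
    (h : ∀ x ∈ Icc (-(1/2) : ℝ) (1/2), f x ≤ g x) : tInt f ≤ tInt g :=
  intervalIntegral.integral_mono_on (by norm_num) (hf.intervalIntegrable _ _)
    (hg.intervalIntegrable _ _) h

lemma tInt_const (c : ℝ) : tInt (fun _ => c) = c := by
  simp only [tInt, intervalIntegral.integral_const, smul_eq_mul]; norm_num

lemma tInt_add {f g : ℝ → ℝ} (hf : Continuous f) (hg : Continuous g) :
    tInt (fun x => f x + g x) = tInt f + tInt g :=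
  intervalIntegral.integral_add (hf.intervalIntegrable _ _) (hg.intervalIntegrable _ _)

lemma tInt_sub {f g : ℝ → ℝ} (hf : Continuous f) (hg : Continuous g) :
    tInt (fun x => f x - g x) = tInt f - tInt g :=
  intervalIntegral.integral_sub (hf.intervalIntegrable _ _) (hg.intervalIntegrable _ _)

lemma tInt_const_mul (c : ℝ) (f : ℝ → ℝ) : tInt (fun x => c * f x) = c * tInt f :=
  intervalIntegral.integral_const_mul _ _

lemma tInt_nonneg {f : ℝ → ℝ} (h : ∀ x, 0 ≤ f x) : 0 ≤ tInt f :=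
  intervalIntegral.integral_nonneg (by norm_num) fun x _ => h x

lemma abs_tInt_le (f : ℝ → ℝ) : |tInt f| ≤ tInt fun x => |f x| :=
  intervalIntegral.abs_integral_le_integral_abs (by norm_num)

lemma tInt_deriv {f f' : ℝ → ℝ} (hf : ∀ x, HasDerivAt f (f' x) x) (hf' : Continuous f')
    (hper : f (1/2) = f (-(1/2))) : tInt f' = 0 := by
  rw [tInt, intervalIntegral.integral_eq_sub_of_hasDerivAt (fun x _ => hf x)
    (hf'.intervalIntegrable _ _), hper, sub_self]

/-- Cauchy–Schwarz over one period. -/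
lemma tInt_mul_le {f g : ℝ → ℝ} (hf : Continuous f) (hg : Continuous g) :
    tInt (fun x => f x * g x) ≤ √(L2sq f) * √(L2sq g) := by
  have hf0 : 0 ≤ L2sq f := tInt_nonneg fun x => sq_nonneg _
  have key : ∀ c : ℝ,
      0 ≤ L2sq f * (c * c) + (-2 * tInt fun x => f x * g x) * c + L2sq g := by
    intro c
    have h : 0 ≤ tInt fun x => (c * f x - g x) ^ 2 := tInt_nonneg fun x => sq_nonneg _
    have h2 : (tInt fun x => (c * f x - g x) ^ 2)
        = tInt fun x => (c * c * (f x) ^ 2 + (-2 * c) * (f x * g x)) + (g x) ^ 2 := by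
      congr 1; ext x; ring
    rw [h2, tInt_add (by fun_prop) (by fun_prop), tInt_add (by fun_prop) (by fun_prop),
      tInt_const_mul, tInt_const_mul] at h
    simp only [L2sq]; linarith
  have hd := discrim_le_zero key
  rw [← Real.sqrt_mul hf0]
  refine Real.le_sqrt_of_sq_le ?_
  rw [discrim] at hd
  nlinarith

lemma tInt_abs_mul_le {f g : ℝ → ℝ} (hf : Continuous f) (hg : Continuous g) :
    tInt (fun x => |f x * g x|) ≤ √(L2sq f) * √(L2sq g) := by
  have := tInt_mul_le hf.abs hg.abs
  simpa only [L2sq, sq_abs, ← abs_mul] using this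

lemma abs_integral_le_tInt_abs {f : ℝ → ℝ} (hf : Continuous f) {x y : ℝ}
    (hx : x ∈ Icc (-(1/2) : ℝ) (1/2)) (hy : y ∈ Icc (-(1/2) : ℝ) (1/2)) :
    |∫ z in y..x, f z| ≤ tInt fun z => |f z| := by
  calc |∫ z in y..x, f z| ≤ abs (∫ z in y..x, |f z|) :=
        intervalIntegral.norm_integral_le_abs_integral_norm (f := f) (μ := volume)
    _ ≤ abs (∫ z in (-(1/2) : ℝ)..(1/2), |f z|) := by
        refine intervalIntegral.abs_integral_mono_interval ?_
          (Filter.Eventually.of_forall fun z => abs_nonneg (f z)) (hf.abs.intervalIntegrable _ _)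
        rw [uIoc, uIoc]
        refine Ioc_subset_Ioc ?_ ?_
        · rw [min_eq_left (by norm_num)]; exact le_min hy.1 hx.1
        · rw [max_eq_right (a := (-(1/2) : ℝ)) (by norm_num)]; exact max_le hy.2 hx.2
    _ = tInt fun z => |f z| := abs_of_nonneg (tInt_nonneg fun z => abs_nonneg (f z))

lemma le_add_tInt_abs_deriv {f f' : ℝ → ℝ} (hf : ∀ x, HasDerivAt f (f' x) x)
    (hf' : Continuous f') {x y : ℝ}
    (hx : x ∈ Icc (-(1/2) : ℝ) (1/2)) (hy : y ∈ Icc (-(1/2) : ℝ) (1/2)) :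
    f x ≤ f y + tInt fun z => |f' z| := by
  have h := intervalIntegral.integral_eq_sub_of_hasDerivAt (a := y) (b := x) (fun z _ => hf z)
    (hf'.intervalIntegrable _ _)
  have h2 := (le_abs_self _).trans (abs_integral_le_tInt_abs hf' hx hy)
  linarith

lemma exists_le_tInt {f : ℝ → ℝ} (hf : Continuous f) :
    ∃ y ∈ Icc (-(1/2) : ℝ) (1/2), f y ≤ tInt f := by
  obtain ⟨y, hy, hmin⟩ := isCompact_Icc.exists_isMinOn (s := Icc (-(1/2) : ℝ) (1/2))
    ⟨0, by norm_num, by norm_num⟩ hf.continuousOn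
  refine ⟨y, hy, ?_⟩
  rw [← tInt_const (f y)]
  exact tInt_mono continuous_const hf fun x hx => hmin hx

/-- Differentiation under the integral sign over an interval. -/
lemma hasDerivAt_integral {f f' : ℝ → ℝ → ℝ}
    (hf : Continuous fun p : ℝ × ℝ => f p.1 p.2) (hf' : Continuous fun p : ℝ × ℝ => f' p.1 p.2)
    {a b t : ℝ} (h : ∀ s ∈ Metric.ball t 1, ∀ x, HasDerivAt (fun r => f r x) (f' s x) s) :
    HasDerivAt (fun s => ∫ x in a..b, f s x) (∫ x in a..b, f' t x) t := by
  obtain ⟨B, hB⟩ := ((isCompact_closedBall t 1).prod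
    (isCompact_uIcc (a := a) (b := b))).exists_bound_of_continuousOn hf'.continuousOn
  have hc : ∀ s, Continuous (f s) := fun s => hf.comp (Continuous.prodMk_right s)
  have hc' : ∀ s, Continuous (f' s) := fun s => hf'.comp (Continuous.prodMk_right s)
  refine (intervalIntegral.hasDerivAt_integral_of_dominated_loc_of_deriv_le
    (bound := fun _ => B) (Metric.ball_mem_nhds t one_pos)
    (Filter.Eventually.of_forall fun s => (hc s).aestronglyMeasurable)
    ((hc t).intervalIntegrable _ _) (hc' t).aestronglyMeasurable
    (Filter.Eventually.of_forall fun x hx s hs =>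
      hB (s, x) ⟨Metric.ball_subset_closedBall hs, uIoc_subset_uIcc hx⟩)
    intervalIntegrable_const
    (Filter.Eventually.of_forall fun x _ s hs => h s hs x)).2

/-- The integral over one period of a density of a conservation law is constant in time. -/
lemma tInt_conserved {f Φ : ℝ → ℝ → ℝ} {T : ℝ} (hf : JointSmooth f) (hΦ : JointSmooth Φ)
    (hper : ∀ t, Φ t (1/2) = Φ t (-(1/2)))
    (heq : ∀ t ∈ Icc (0 : ℝ) T, ∀ x, pt f t x = px Φ t x) :
    ∀ t ∈ Icc (0 : ℝ) T, tInt (f t) = tInt (f 0) := by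
  have hd : ∀ t, HasDerivAt (fun s => tInt (f s)) (tInt (pt f t)) t := fun t =>
    hasDerivAt_integral hf.continuous hf.pt.continuous fun s _ x => hf.hasDerivAt_pt s x
  refine constant_of_has_deriv_right_zero
    (fun t _ => (hd t).continuousAt.continuousWithinAt) fun t ht => ?_
  have h0 : tInt (pt f t) = 0 := by
    have : pt f t = px Φ t := funext (heq t (Ico_subset_Icc_self ht))
    rw [this]
    exact tInt_deriv (hΦ.hasDerivAt_px t) (hΦ.px.continuous_slice t) (hper t)
  exact h0 ▸ (hd t).hasDerivWithinAt

lemma continuous_tInt {f : ℝ → ℝ → ℝ} (hf : Continuous fun p : ℝ × ℝ => f p.1 p.2) :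
    Continuous fun t => tInt (f t) :=
  intervalIntegral.continuous_parametric_intervalIntegral_of_continuous' hf _ _

lemma le_sSup_tInt {f : ℝ → ℝ → ℝ} (hf : Continuous fun p : ℝ × ℝ => f p.1 p.2) {s t : ℝ}
    (hs : s ∈ Icc (0 : ℝ) t) :
    tInt (f s) ≤ sSup ((fun s => tInt (f s)) '' Icc (0 : ℝ) t) :=
  le_csSup (isCompact_Icc.image (continuous_tInt hf)).bddAbove (mem_image_of_mem _ hs)

lemma tInt_abs_le_one_add_L2sq {f : ℝ → ℝ} (hf : Continuous f) :
    tInt (fun x => |f x|) ≤ 1 + L2sq f := by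
  have hf2 : Continuous fun x => f x ^ 2 := hf.pow 2
  have h := tInt_mono hf.abs (continuous_const.add hf2) (g := fun x => 1 + f x ^ 2)
    fun x _ => by nlinarith [sq_nonneg (|f x| - 1), sq_abs (f x)]
  rwa [tInt_add continuous_const hf2, tInt_const] at h

lemma continuous_primitive {f : ℝ → ℝ → ℝ} (hf : Continuous fun p : ℝ × ℝ => f p.1 p.2) (a : ℝ) :
    Continuous fun p : ℝ × ℝ => ∫ z in a..p.2, f p.1 z :=
  intervalIntegral.continuous_parametric_primitive_of_continuous (f := f) (by exact hf)

/-! ### A priori bounds -/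

namespace Sol

variable {μ R a b κ₁ κ₂ β γ T : ℝ} (S : Sol μ R a b κ₁ κ₂ β γ T)

lemma L2sq_nonneg (f : ℝ → ℝ) : 0 ≤ L2sq f := tInt_nonneg fun _ => sq_nonneg _

lemma Bounded.sq_le {S : Sol μ R a b κ₁ κ₂ β γ T} {M ε : ℝ} (hS : S.Bounded M ε) (hM : 1 ≤ M) :
    L2sq (S.u 0) ≤ M ^ 2 ∧ L2sq (S.θ 0) ≤ M ^ 2 ∧ L2sq (px S.v 0) ≤ M ^ 2 := by
  have h := (Real.sqrt_le_left (by linarith)).1 hS.1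
  simp only [H2sq] at h
  change L2sq (S.u 0) ≤ M ^ 2 ∧ L2sq (S.θ 0) ≤ M ^ 2 ∧ L2sq (deriv (S.v 0)) ≤ M ^ 2
  have hn := L2sq_nonneg
  refine ⟨?_, ?_, ?_⟩ <;>
  linarith [hn (S.v 0), hn (S.u 0), hn (S.θ 0), hn (deriv (S.v 0)), hn (deriv (S.u 0)),
    hn (deriv (S.θ 0)), hn (deriv (deriv (S.v 0))), hn (deriv (deriv (S.u 0))),
    hn (deriv (deriv (S.θ 0)))]

lemma smooth_kappa : JointSmooth fun t x => kappa κ₁ κ₂ β (S.v t x) (S.θ t x) :=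
  contDiff_const.add ((contDiff_const.mul S.smooth_v).mul
    (S.smooth_θ.rpow_const_of_ne fun p => (S.θ_pos p.1 p.2).ne.symm))

/-- The effective viscous stress `μ u_x / v - R θ / v`. -/
def stress (t x : ℝ) : ℝ := μ * px S.u t x / S.v t x - R * S.θ t x / S.v t x

lemma smooth_viscous : JointSmooth fun t x => μ * px S.u t x / S.v t x :=
  (contDiff_const.mul (JointSmooth.px S.smooth_u)).div S.smooth_v fun p => (S.v_pos p.1 p.2).ne'

lemma smooth_pressure : JointSmooth fun t x => R * S.θ t x / S.v t x :=
  (contDiff_const.mul S.smooth_θ).div S.smooth_v fun p => (S.v_pos p.1 p.2).ne'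

lemma smooth_stress : JointSmooth S.stress :=
  ContDiff.sub S.smooth_viscous S.smooth_pressure

lemma periodic_stress (t : ℝ) : Function.Periodic (S.stress t) 1 := fun x => by
  simp only [stress, S.periodic_v t x, S.periodic_θ t x, periodic_px S.periodic_u t x]

lemma pt_u_eq {t : ℝ} (ht : t ∈ Icc 0 T) (x : ℝ) : pt S.u t x = px S.stress t x := by
  have h : HasDerivAt (S.stress t) _ x :=
    (S.smooth_viscous.hasDerivAt_px t x).sub (S.smooth_pressure.hasDerivAt_px t x)
  have h2 : px S.stress t x = _ := h.deriv
  rw [h2, ← S.eq_mom t ht x]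
  ring

lemma tInt_v {t : ℝ} (ht : t ∈ Icc 0 T) : tInt (S.v t) = 1 := by
  rw [← S.mean_v]
  exact tInt_conserved S.smooth_v S.smooth_u (fun t => periodic_endpoints (S.periodic_u t))
    (fun t ht x => sub_eq_zero.1 (S.eq_mass t ht x)) t ht

lemma tInt_u {t : ℝ} (ht : t ∈ Icc 0 T) : tInt (S.u t) = tInt (S.u 0) :=
  tInt_conserved S.smooth_u S.smooth_stress (fun t => periodic_endpoints (S.periodic_stress t))
    (fun _ ht x => S.pt_u_eq ht x) t ht

lemma tInt_energy {t : ℝ} (ht : t ∈ Icc 0 T) :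
    R / (γ - 1) * tInt (S.θ t) + L2sq (S.u t) / 2
      = R / (γ - 1) * tInt (S.θ 0) + L2sq (S.u 0) / 2 := by
  have he : JointSmooth fun s y => R / (γ - 1) * S.θ s y + (S.u s y) ^ 2 / 2 :=
    (contDiff_const.mul S.smooth_θ).add ((S.smooth_u.pow 2).div_const 2)
  have hne : ∀ p : ℝ × ℝ, S.v p.1 p.2 ≠ 0 := fun p => (S.v_pos p.1 p.2).ne'
  have h1 : JointSmooth fun s y => μ * S.u s y * px S.u s y / S.v s y :=
    ((contDiff_const.mul S.smooth_u).mul (JointSmooth.px S.smooth_u)).div S.smooth_v hne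
  have h2 : JointSmooth fun s y =>
      kappa κ₁ κ₂ β (S.v s y) (S.θ s y) * px S.θ s y / S.v s y :=
    (S.smooth_kappa.mul (JointSmooth.px S.smooth_θ)).div S.smooth_v hne
  have h3 : JointSmooth fun s y => R * S.θ s y / S.v s y * S.u s y :=
    S.smooth_pressure.mul S.smooth_u
  have hflux := ((ContDiff.add h1 h2).sub h3).sub S.smooth_q
  have hcons := tInt_conserved (T := T) he (Φ := fun s y => μ * S.u s y * px S.u s y / S.v s y
      + kappa κ₁ κ₂ β (S.v s y) (S.θ s y) * px S.θ s y / S.v s y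
      - R * S.θ s y / S.v s y * S.u s y - S.q s y) hflux
    (fun s => by
      simp only [periodic_endpoints (S.periodic_v s), periodic_endpoints (S.periodic_θ s),
        periodic_endpoints (S.periodic_u s), periodic_endpoints (S.periodic_q s),
        periodic_endpoints (periodic_px S.periodic_u s),
        periodic_endpoints (periodic_px S.periodic_θ s)])
    (fun s hs x => by
      have hd := (((h1.hasDerivAt_px s x).add (h2.hasDerivAt_px s x)).sub
        (h3.hasDerivAt_px s x)).sub (JointSmooth.hasDerivAt_px S.smooth_q s x)
      refine Eq.trans ?_ hd.deriv.symm
      linarith [S.eq_energy s hs x]) t ht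
  have hsplit : ∀ s, (tInt fun y => R / (γ - 1) * S.θ s y + (S.u s y) ^ 2 / 2)
      = R / (γ - 1) * tInt (S.θ s) + L2sq (S.u s) / 2 := by
    intro s
    have hθ := JointSmooth.continuous_slice S.smooth_θ s
    have hu := JointSmooth.continuous_slice S.smooth_u s
    have hu2 : Continuous fun y => S.u s y ^ 2 := hu.pow 2
    have h := tInt_add (hθ.const_mul (R / (γ - 1))) (hu2.const_mul (1 / 2))
    rw [tInt_const_mul, tInt_const_mul] at h
    calc _ = tInt fun y => R / (γ - 1) * S.θ s y + 1 / 2 * (S.u s y) ^ 2 := by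
          congr 1; ext y; ring
      _ = _ := h
      _ = _ := by simp only [L2sq]; ring
  rw [← hsplit, ← hsplit]
  exact hcons

lemma energy_le {M ε : ℝ} (hR : 0 < R) (hγ : 1 < γ) (hM : 1 ≤ M) (hS : S.Bounded M ε)
    {t : ℝ} (ht : t ∈ Icc 0 T) :
    R / (γ - 1) * tInt (S.θ t) + L2sq (S.u t) / 2
      ≤ R / (γ - 1) * (1 + M ^ 2) + M ^ 2 / 2 := by
  obtain ⟨hu, hθ, -⟩ := hS.sq_le hM
  have hc : 0 < R / (γ - 1) := div_pos hR (by linarith)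
  have hθc := JointSmooth.continuous_slice S.smooth_θ 0
  have h1 : tInt (S.θ 0) ≤ 1 + L2sq (S.θ 0) :=
    (le_abs_self _).trans ((abs_tInt_le _).trans (tInt_abs_le_one_add_L2sq hθc))
  rw [S.tInt_energy ht]
  have := mul_le_mul_of_nonneg_left (h1.trans (add_le_add_right hθ 1)) hc.le
  linarith

lemma v_zero_le {M ε : ℝ} (hM : 1 ≤ M) (hS : S.Bounded M ε) {x : ℝ}
    (hx : x ∈ Icc (-(1/2) : ℝ) (1/2)) : S.v 0 x ≤ 2 + M ^ 2 := by
  obtain ⟨-, -, hv⟩ := hS.sq_le hM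
  have hc := (JointSmooth.px S.smooth_v).continuous_slice 0
  obtain ⟨y, hy, hle⟩ := exists_le_tInt (JointSmooth.continuous_slice S.smooth_v 0)
  have h1 := le_add_tInt_abs_deriv (JointSmooth.hasDerivAt_px S.smooth_v 0) hc hx hy
  have h2 := tInt_abs_le_one_add_L2sq hc
  linarith [S.mean_v]

lemma continuous_Y_integrand : Continuous fun p : ℝ × ℝ =>
    (kappa κ₁ κ₂ β (S.v p.1 p.2) (S.θ p.1 p.2)) ^ 2 * (px S.θ p.1 p.2) ^ 2
      / (S.v p.1 p.2) ^ 2 :=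
  (((S.smooth_kappa.continuous.pow 2).mul ((JointSmooth.px S.smooth_θ).continuous.pow 2)).div
    (S.smooth_v.continuous.pow 2)) fun p => pow_ne_zero 2 (S.v_pos p.1 p.2).ne'

lemma continuous_Z_integrand : Continuous fun p : ℝ × ℝ =>
    (px (px S.u) p.1 p.2) ^ 2 / (S.v p.1 p.2) ^ 2 :=
  (((JointSmooth.px (JointSmooth.px S.smooth_u)).continuous.pow 2).div
    (S.smooth_v.continuous.pow 2)) fun p => pow_ne_zero 2 (S.v_pos p.1 p.2).ne'

lemma Y_nonneg (t : ℝ) : 0 ≤ S.Y t := by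
  refine Real.sSup_nonneg ?_
  rintro _ ⟨s, -, rfl⟩
  exact tInt_nonneg fun x => by positivity

lemma Z_nonneg (t : ℝ) : 0 ≤ S.Z t := by
  refine Real.sSup_nonneg ?_
  rintro _ ⟨s, -, rfl⟩
  exact tInt_nonneg fun x => by positivity

lemma theta_rpow_le (hκ₁ : 0 < κ₁) (hκ₂ : 0 < κ₂) (hβ : 0 < β) {K s t x : ℝ}
    (hK : tInt (S.θ s) ≤ K) (hs : s ∈ Icc 0 t) (hx : x ∈ Icc (-(1/2) : ℝ) (1/2)) :
    S.θ s x ^ (β + 3/2)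
      ≤ K ^ (β + 3/2) + (β + 3/2) * (√K * (1 / κ₂ * √(S.Y t))) := by
  have hθ := JointSmooth.continuous_slice S.smooth_θ s
  have hθx := (JointSmooth.px S.smooth_θ).continuous_slice s
  have hv := JointSmooth.continuous_slice S.smooth_v s
  have hpos := S.θ_pos s
  have hθβ : Continuous fun y => S.θ s y ^ β := hθ.rpow_const fun y => Or.inl (hpos y).ne'
  obtain ⟨y, hy, hle⟩ := exists_le_tInt hθ
  have hd : ∀ z, HasDerivAt (fun y => S.θ s y ^ (β + 3/2))
      ((β + 3/2) * (√(S.θ s z) * (S.θ s z ^ β * px S.θ s z))) z := by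
    intro z
    convert (JointSmooth.hasDerivAt_px S.smooth_θ s z).rpow_const (p := β + 3/2)
      (Or.inl (hpos z).ne') using 1
    rw [show β + 3/2 - 1 = 1/2 + β by ring, Real.rpow_add (hpos z), Real.sqrt_eq_rpow]
    ring
  have hcont : Continuous fun z =>
      (β + 3/2) * (√(S.θ s z) * (S.θ s z ^ β * px S.θ s z)) :=
    (hθ.sqrt.mul (hθβ.mul hθx)).const_mul _
  have h1 := le_add_tInt_abs_deriv hd hcont hx hy
  have h2 : (tInt fun z => |(β + 3/2) * (√(S.θ s z) * (S.θ s z ^ β * px S.θ s z))|)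
      = (β + 3/2) * tInt fun z => |√(S.θ s z) * (S.θ s z ^ β * px S.θ s z)| := by
    rw [← tInt_const_mul]
    congr 1; ext z
    rw [abs_mul, abs_of_pos (a := β + 3/2) (by positivity)]
  have h3 := tInt_abs_mul_le hθ.sqrt (hθβ.mul hθx)
  have h4 : L2sq (fun z => √(S.θ s z)) = tInt (S.θ s) := by
    simp only [L2sq]; congr 1; ext z; exact Real.sq_sqrt (hpos z).le
  have h5 : L2sq (fun z => S.θ s z ^ β * px S.θ s z) ≤ (1 / κ₂) ^ 2 * S.Y t := by
    have hY : _ ≤ S.Y t := le_sSup_tInt S.continuous_Y_integrand hs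
    refine le_trans ?_ (mul_le_mul_of_nonneg_left hY (by positivity))
    rw [← tInt_const_mul]
    refine tInt_mono ((hθβ.mul hθx).pow 2)
      ((S.continuous_Y_integrand.comp (Continuous.prodMk_right s)).const_mul _) fun z _ => ?_
    have hvz := S.v_pos s z
    have hk : κ₂ * S.v s z * S.θ s z ^ β ≤ kappa κ₁ κ₂ β (S.v s z) (S.θ s z) := by
      rw [kappa]; linarith
    have hk2 := mul_le_mul_of_nonneg_right
      (pow_le_pow_left₀ (by have := hpos z; positivity) hk 2) (sq_nonneg (px S.θ s z))
    rw [← mul_div_assoc, le_div_iff₀ (by positivity), one_div, inv_pow, ← div_eq_inv_mul,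
      le_div_iff₀ (by positivity)]
    linarith
  have h6 : √(L2sq fun z => S.θ s z ^ β * px S.θ s z) ≤ 1 / κ₂ * √(S.Y t) := by
    rw [← Real.sqrt_sq (show 0 ≤ 1 / κ₂ by positivity), ← Real.sqrt_mul (sq_nonneg _)]
    exact Real.sqrt_le_sqrt h5
  have h7 : S.θ s y ^ (β + 3/2) ≤ K ^ (β + 3/2) :=
    Real.rpow_le_rpow (hpos y).le (hle.trans hK) (by positivity)
  rw [h2] at h1
  rw [h4] at h3
  have h8 : √(tInt (S.θ s)) * √(L2sq fun z => S.θ s z ^ β * px S.θ s z)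
      ≤ √K * (1 / κ₂ * √(S.Y t)) :=
    mul_le_mul (Real.sqrt_le_sqrt hK) h6 (Real.sqrt_nonneg _) (Real.sqrt_nonneg _)
  exact h1.trans (add_le_add h7 (mul_le_mul_of_nonneg_left (h3.trans h8) (by positivity)))

lemma theta_le (hκ₁ : 0 < κ₁) (hκ₂ : 0 < κ₂) (hβ : 0 < β) {K s t x : ℝ} (hK0 : 0 ≤ K)
    (hK : tInt (S.θ s) ≤ K) (hs : s ∈ Icc 0 t) (hx : x ∈ Icc (-(1/2) : ℝ) (1/2)) :
    S.θ s x ≤ (K ^ (β + 3/2) + (β + 3/2) * (√K * (1 / κ₂))) ^ (1 / (β + 3/2))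
      * (1 + S.Y t ^ (1 / (2 * β + 3))) := by
  set D := K ^ (β + 3/2) + (β + 3/2) * (√K * (1 / κ₂)) with hD
  have hp : 0 < β + 3/2 := by positivity
  have hD0 : 0 ≤ D := by positivity
  have h := S.theta_rpow_le hκ₁ hκ₂ hβ hK hs hx
  have hY := S.Y_nonneg t
  have hsq := Real.sqrt_nonneg (S.Y t)
  have h1 : S.θ s x ^ (β + 3/2) ≤ D * (1 + √(S.Y t)) := by
    have h2 : 0 ≤ K ^ (β + 3/2) * √(S.Y t) := by positivity
    have h3 : 0 ≤ (β + 3/2) * (√K * (1 / κ₂)) := by positivity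
    rw [hD]; nlinarith
  have h2 := Real.rpow_le_rpow (by have := S.θ_pos s x; positivity) h1
    (show 0 ≤ 1 / (β + 3/2) by positivity)
  rw [← Real.rpow_mul (S.θ_pos s x).le, mul_one_div_cancel hp.ne', Real.rpow_one,
    Real.mul_rpow hD0 (by positivity)] at h2
  refine h2.trans (mul_le_mul_of_nonneg_left ?_ (by positivity))
  refine (Real.rpow_add_le_add_rpow zero_le_one hsq (by positivity)
    ((div_le_one hp).2 (by linarith))).trans ?_
  rw [Real.one_rpow, Real.sqrt_eq_rpow, ← Real.rpow_mul hY]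
  refine le_of_eq ?_
  congr 2
  field_simp

/-- A periodic-in-space potential of the velocity fluctuation. -/
def potential (t x : ℝ) : ℝ := ∫ z in (-(1/2) : ℝ)..x, (S.u t z - tInt (S.u 0))

/-- The average of the potential against the specific volume. -/
def potentialMean (t : ℝ) : ℝ := tInt fun x => S.v t x * S.potential t x

lemma continuous_u_sub : Continuous fun p : ℝ × ℝ => S.u p.1 p.2 - tInt (S.u 0) :=
  S.smooth_u.continuous.sub continuous_const

lemma continuous_potential : Continuous fun p : ℝ × ℝ => S.potential p.1 p.2 :=
  continuous_primitive (f := fun t z => S.u t z - tInt (S.u 0)) S.continuous_u_sub _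

lemma hasDerivAt_potential_time (t x : ℝ) :
    HasDerivAt (fun s => S.potential s x) (∫ z in (-(1/2) : ℝ)..x, pt S.u t z) t :=
  hasDerivAt_integral S.continuous_u_sub (JointSmooth.pt S.smooth_u).continuous fun s _ z =>
    (JointSmooth.hasDerivAt_pt S.smooth_u s z).sub_const _

lemma hasDerivAt_potential_space (t x : ℝ) :
    HasDerivAt (S.potential t) (S.u t x - tInt (S.u 0)) x := by
  have hc : Continuous fun z => S.u t z - tInt (S.u 0) :=
    S.continuous_u_sub.comp (Continuous.prodMk_right t)
  exact intervalIntegral.integral_hasDerivAt_right (hc.intervalIntegrable _ _)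
    hc.aestronglyMeasurable.stronglyMeasurableAtFilter hc.continuousAt

lemma potential_left (t : ℝ) : S.potential t (-(1/2)) = 0 :=
  intervalIntegral.integral_same

lemma potential_right {t : ℝ} (ht : t ∈ Icc 0 T) : S.potential t (1/2) = 0 := by
  have h := tInt_sub (JointSmooth.continuous_slice S.smooth_u t)
    (continuous_const (y := tInt (S.u 0)))
  rw [tInt_const, S.tInt_u ht, sub_self] at h
  exact h

lemma hasDerivAt_potentialMean (t : ℝ) :
    HasDerivAt S.potentialMean (tInt fun x => pt S.v t x * S.potential t x
      + S.v t x * ∫ z in (-(1/2) : ℝ)..x, pt S.u t z) t :=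
  hasDerivAt_integral (S.smooth_v.continuous.mul S.continuous_potential)
    (((JointSmooth.pt S.smooth_v).continuous.mul S.continuous_potential).add
      (S.smooth_v.continuous.mul
        (continuous_primitive (JointSmooth.pt S.smooth_u).continuous _)))
    fun s _ x => (JointSmooth.hasDerivAt_pt S.smooth_v s x).mul (S.hasDerivAt_potential_time s x)

lemma integral_pt_u {t : ℝ} (ht : t ∈ Icc 0 T) (x : ℝ) :
    ∫ z in (-(1/2) : ℝ)..x, pt S.u t z = S.stress t x - S.stress t (-(1/2)) := by
  rw [show pt S.u t = px S.stress t from funext (S.pt_u_eq ht)]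
  exact intervalIntegral.integral_eq_sub_of_hasDerivAt
    (fun z _ => S.smooth_stress.hasDerivAt_px t z)
    ((S.smooth_stress.px.continuous_slice t).intervalIntegrable _ _)

lemma deriv_potentialMean_eq {t : ℝ} (ht : t ∈ Icc 0 T) :
    (tInt fun x => pt S.v t x * S.potential t x
      + S.v t x * ∫ z in (-(1/2) : ℝ)..x, pt S.u t z)
      = -(tInt fun x => (S.u t x - tInt (S.u 0)) ^ 2 + R * S.θ t x)
        - S.stress t (-(1/2)) := by
  set m := tInt (S.u 0) with hm
  set c := S.stress t (-(1/2)) with hc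
  have hu := JointSmooth.continuous_slice S.smooth_u t
  have hux := (JointSmooth.px S.smooth_u).continuous_slice t
  have hv := JointSmooth.continuous_slice S.smooth_v t
  have hθ := JointSmooth.continuous_slice S.smooth_θ t
  have hP : Continuous (S.potential t) :=
    S.continuous_potential.comp (Continuous.prodMk_right t)
  have hd : ∀ x, HasDerivAt (fun x => (S.u t x - m) * S.potential t x + μ * S.u t x)
      (px S.u t x * S.potential t x + (S.u t x - m) * (S.u t x - m) + μ * px S.u t x) x :=
    fun x => ((((JointSmooth.hasDerivAt_px S.smooth_u t x).sub_const m).mul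
      (S.hasDerivAt_potential_space t x)).add
      ((JointSmooth.hasDerivAt_px S.smooth_u t x).const_mul μ))
  have hdc : Continuous fun x =>
      px S.u t x * S.potential t x + (S.u t x - m) * (S.u t x - m) + μ * px S.u t x := by
    fun_prop
  have h0 := tInt_deriv hd hdc (by
    rw [S.potential_left, S.potential_right ht, periodic_endpoints (S.periodic_u t)])
  have hAc : Continuous fun x => (S.u t x - m) ^ 2 + R * S.θ t x := by fun_prop
  have hcv : Continuous fun x => c * S.v t x := by fun_prop
  have hAcv : Continuous fun x => (S.u t x - m) ^ 2 + R * S.θ t x + c * S.v t x := hAc.add hcv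
  have h1 := tInt_sub hdc hAcv
  rw [tInt_add hAc hcv, h0, tInt_const_mul, S.tInt_v ht] at h1
  refine Eq.trans ?_ (h1.trans (by ring))
  congr 1
  ext x
  have hvx := (S.v_pos t x).ne'
  rw [S.integral_pt_u ht, ← hc, sub_eq_zero.1 (S.eq_mass t ht x), stress]
  field_simp
  ring

lemma abs_potential_le {K t x : ℝ} (hK : ∀ s ∈ Icc 0 T, L2sq (S.u s) ≤ K) (ht : t ∈ Icc 0 T)
    (hx : x ∈ Icc (-(1/2) : ℝ) (1/2)) : |S.potential t x| ≤ 2 * (1 + K) := by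
  have h0 : (0 : ℝ) ∈ Icc 0 T := ⟨le_rfl, ht.1.trans ht.2⟩
  have hu := JointSmooth.continuous_slice S.smooth_u t
  have hu0 := JointSmooth.continuous_slice S.smooth_u 0
  have hc : Continuous fun z => S.u t z - tInt (S.u 0) := hu.sub continuous_const
  have h1 : |S.potential t x| ≤ _ := abs_integral_le_tInt_abs hc hx ⟨le_rfl, by norm_num⟩
  have h2 := tInt_mono (g := fun z => |S.u t z| + |tInt (S.u 0)|) hc.abs (by fun_prop)
    fun z _ => abs_sub _ _
  rw [tInt_add hu.abs continuous_const, tInt_const] at h2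
  have h3 := tInt_abs_le_one_add_L2sq hu
  have h4 := (abs_tInt_le (S.u 0)).trans (tInt_abs_le_one_add_L2sq hu0)
  linarith [hK t ht, hK 0 h0]

lemma abs_potentialMean_le {K t : ℝ} (hK : ∀ s ∈ Icc 0 T, L2sq (S.u s) ≤ K)
    (ht : t ∈ Icc 0 T) : |S.potentialMean t| ≤ 2 * (1 + K) := by
  have hv := JointSmooth.continuous_slice S.smooth_v t
  have hP : Continuous (S.potential t) :=
    S.continuous_potential.comp (Continuous.prodMk_right t)
  refine (abs_tInt_le _).trans ?_
  have h := tInt_mono (f := fun x => |S.v t x * S.potential t x|) (hv.mul hP).abs (hv.const_mul (2 * (1 + K))) fun x hx => by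
    rw [abs_mul, abs_of_pos (S.v_pos t x), mul_comm]
    exact mul_le_mul_of_nonneg_right (S.abs_potential_le hK ht hx) (S.v_pos t x).le
  rwa [tInt_const_mul, S.tInt_v ht, mul_one] at h

/-- Kazhikhov-type upper bound for the specific volume. -/
lemma v_le (hμ : 0 < μ) (hR : 0 < R) {K V Θ t : ℝ} (hK : ∀ s ∈ Icc 0 T, L2sq (S.u s) ≤ K)
    (hV : ∀ x ∈ Icc (-(1/2) : ℝ) (1/2), S.v 0 x ≤ V) (ht : t ∈ Icc 0 T)
    (hΘ : ∀ s ∈ Icc 0 t, ∀ x ∈ Icc (-(1/2) : ℝ) (1/2), S.θ s x ≤ Θ)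
    {x : ℝ} (hx : x ∈ Icc (-(1/2) : ℝ) (1/2)) :
    S.v t x ≤ rexp (8 * (1 + K) / μ) * (V + R / μ * T * Θ) := by
  have h0 : (0 : ℝ) ∈ Icc 0 T := ⟨le_rfl, ht.1.trans ht.2⟩
  set G : ℝ → ℝ := fun s => S.potential s x - S.potentialMean s with hG
  set J : ℝ → ℝ := fun s => tInt fun x => pt S.v s x * S.potential s x
      + S.v s x * ∫ z in (-(1/2) : ℝ)..x, pt S.u s z with hJ
  set E : ℝ := rexp (4 * (1 + K) / μ) with hE
  have hGabs : ∀ s ∈ Icc 0 T, |G s| ≤ 4 * (1 + K) := fun s hs => by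
    have := abs_sub (S.potential s x) (S.potentialMean s)
    have h1 := S.abs_potential_le hK hs hx
    have h2 := S.abs_potentialMean_le hK hs
    simp only [hG]; linarith
  have hexp : ∀ s ∈ Icc 0 T, rexp (-G s / μ) ≤ E := fun s hs =>
    Real.exp_le_exp.2 (div_le_div_of_nonneg_right
      ((neg_le_abs _).trans (hGabs s hs)) hμ.le)
  set W : ℝ → ℝ := fun s => S.v s x * rexp (-G s / μ) with hW
  have hWd : ∀ s, HasDerivAt W (pt S.v s x * rexp (-G s / μ) + S.v s x * (rexp (-G s / μ)
      * (-((∫ z in (-(1/2) : ℝ)..x, pt S.u s z) - J s) / μ))) s := fun s =>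
    (JointSmooth.hasDerivAt_pt S.smooth_v s x).mul
      ((((S.hasDerivAt_potential_time s x).sub (S.hasDerivAt_potentialMean s)).neg.div_const
        μ).exp)
  have hΘ0 : 0 < Θ := (S.θ_pos 0 x).trans_le (hΘ 0 ⟨le_rfl, ht.1⟩ x hx)
  have hbound : ∀ s ∈ Icc 0 t, deriv W s ≤ E * (R / μ * Θ) := by
    intro s hs
    have hsT : s ∈ Icc 0 T := ⟨hs.1, hs.2.trans ht.2⟩
    have hA : 0 ≤ tInt fun x => (S.u s x - tInt (S.u 0)) ^ 2 + R * S.θ s x :=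
      tInt_nonneg fun y => by have := S.θ_pos s y; positivity
    have hvx := S.v_pos s x
    rw [(hWd s).deriv, hJ]
    dsimp only
    rw [S.deriv_potentialMean_eq hsT, S.integral_pt_u hsT, sub_eq_zero.1 (S.eq_mass s hsT x)]
    set A := tInt fun x => (S.u s x - tInt (S.u 0)) ^ 2 + R * S.θ s x
    have heq : px S.u s x * rexp (-G s / μ) + S.v s x * (rexp (-G s / μ)
        * (-(S.stress s x - S.stress s (-(1/2)) - (-A - S.stress s (-(1/2)))) / μ))
        = rexp (-G s / μ) * (R / μ * S.θ s x - S.v s x * A / μ) := by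
      rw [stress]
      field_simp
      ring
    rw [heq]
    have h1 : R / μ * S.θ s x - S.v s x * A / μ ≤ R / μ * Θ := by
      have h2 : 0 ≤ S.v s x * A / μ := by positivity
      have h3 := mul_le_mul_of_nonneg_left (hΘ s hs x hx) (show 0 ≤ R / μ by positivity)
      linarith
    exact (mul_le_mul_of_nonneg_left h1 (Real.exp_pos _).le).trans
      (mul_le_mul_of_nonneg_right (hexp s hsT) (by positivity))
  have hW1 := (convex_Icc (0 : ℝ) t).image_sub_le_mul_sub_of_deriv_le
    (fun s _ => (hWd s).continuousAt.continuousWithinAt)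
    (fun s _ => (hWd s).differentiableAt.differentiableWithinAt)
    (fun s hs => hbound s (interior_subset hs)) 0 ⟨le_rfl, ht.1⟩ t ⟨ht.1, le_rfl⟩ ht.1
  have hW0 : W 0 ≤ V * E :=
    mul_le_mul (hV x hx) (hexp 0 h0) (Real.exp_pos _).le ((S.v_pos 0 x).le.trans (hV x hx))
  have hWt : W t ≤ E * (V + R / μ * T * Θ) := by
    have h1 : E * (R / μ * Θ) * (t - 0) ≤ E * (R / μ * Θ) * T :=
      mul_le_mul_of_nonneg_left (by linarith [ht.2]) (by positivity)
    linarith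
  have hvW : S.v t x = rexp (G t / μ) * W t := by
    simp only [hW]
    rw [mul_left_comm, ← Real.exp_add, neg_div, add_neg_cancel, Real.exp_zero, mul_one]
  have hexp' : rexp (G t / μ) ≤ E := Real.exp_le_exp.2 (div_le_div_of_nonneg_right
    ((le_abs_self _).trans (hGabs t ht)) hμ.le)
  have hE2 : rexp (8 * (1 + K) / μ) = E * E := by
    rw [hE, ← Real.exp_add]; congr 1; ring
  have hWpos : 0 ≤ W t := by have := S.v_pos t x; positivity
  rw [hvW, hE2, mul_assoc]
  exact mul_le_mul hexp' hWt hWpos (Real.exp_pos _).le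

lemma L2sq_px_px_u_le {V t : ℝ} (hV : ∀ x ∈ Icc (-(1/2) : ℝ) (1/2), S.v t x ≤ V)
    (ht : 0 ≤ t) : L2sq (px (px S.u) t) ≤ V ^ 2 * S.Z t := by
  have hZ : _ ≤ S.Z t := le_sSup_tInt S.continuous_Z_integrand ⟨ht, le_rfl⟩
  refine le_trans ?_ (mul_le_mul_of_nonneg_left hZ (sq_nonneg V))
  have hc := (JointSmooth.px (JointSmooth.px S.smooth_u)).continuous_slice t
  rw [← tInt_const_mul]
  refine tInt_mono (hc.pow 2)
    ((S.continuous_Z_integrand.comp (Continuous.prodMk_right t)).const_mul _) fun x hx => ?_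
  have hvx := S.v_pos t x
  rw [← mul_div_assoc, le_div_iff₀ (by positivity), mul_comm]
  exact mul_le_mul_of_nonneg_right (pow_le_pow_left₀ hvx.le (hV x hx) 2) (sq_nonneg _)

lemma sqrt_L2sq_px_px_u_le {V t : ℝ} (hV : ∀ x ∈ Icc (-(1/2) : ℝ) (1/2), S.v t x ≤ V)
    (ht : 0 ≤ t) : √(L2sq (px (px S.u) t)) ≤ V * √(S.Z t) := by
  have hV0 : 0 ≤ V := (S.v_pos t 0).le.trans (hV 0 ⟨by norm_num, by norm_num⟩)
  refine (Real.sqrt_le_sqrt (S.L2sq_px_px_u_le hV ht)).trans ?_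
  rw [Real.sqrt_mul (sq_nonneg V), Real.sqrt_sq hV0]

lemma L2sq_px_u_le (t : ℝ) :
    L2sq (px S.u t) ≤ √(L2sq (S.u t)) * √(L2sq (px (px S.u) t)) := by
  have hu := JointSmooth.continuous_slice S.smooth_u t
  have hux := (JointSmooth.px S.smooth_u).continuous_slice t
  have huxx := (JointSmooth.px (JointSmooth.px S.smooth_u)).continuous_slice t
  have h0 := tInt_deriv (f := fun x => S.u t x * px S.u t x)
    (fun x => (JointSmooth.hasDerivAt_px S.smooth_u t x).mul
      ((JointSmooth.px S.smooth_u).hasDerivAt_px t x))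
    ((hux.mul hux).add (hu.mul huxx)) (by
      simp only [periodic_endpoints (S.periodic_u t),
        periodic_endpoints (periodic_px S.periodic_u t)])
  have hadd := tInt_add (f := fun x => px S.u t x * px S.u t x)
    (g := fun x => S.u t x * px (px S.u) t x) (hux.mul hux) (hu.mul huxx)
  rw [hadd] at h0
  have h1 := (neg_le_abs _).trans ((abs_tInt_le _).trans (tInt_abs_mul_le hu huxx))
  have h2 : L2sq (px S.u t) = tInt fun x => px S.u t x * px S.u t x := by
    simp only [L2sq, sq]
  linarith

lemma px_u_sq_le {t x : ℝ} (hx : x ∈ Icc (-(1/2) : ℝ) (1/2)) :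
    px S.u t x ^ 2 ≤ 2 * (√(L2sq (px S.u t)) * √(L2sq (px (px S.u) t))) := by
  have hux := (JointSmooth.px S.smooth_u).continuous_slice t
  have huxx := (JointSmooth.px (JointSmooth.px S.smooth_u)).continuous_slice t
  obtain ⟨y, hy, hy0⟩ := exists_deriv_eq_zero (f := S.u t) (a := -(1/2)) (b := 1/2)
    (by norm_num) (JointSmooth.continuous_slice S.smooth_u t).continuousOn
    (periodic_endpoints (S.periodic_u t)).symm
  have h := le_add_tInt_abs_deriv (f := fun x => px S.u t x ^ 2)
    (f' := fun x => 2 * (px S.u t x * px (px S.u) t x))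
    (fun z => (((JointSmooth.px S.smooth_u).hasDerivAt_px t z).pow 2).congr_deriv
      (by push_cast; ring)) (by fun_prop) hx (Ioo_subset_Icc_self hy)
  have hy0' : px S.u t y = 0 := hy0
  simp only [hy0', abs_mul (2 : ℝ), tInt_const_mul, abs_two] at h
  have h1 := tInt_abs_mul_le hux huxx
  linarith

/-- The kinetic energy is bounded, and the specific volume grows at most like the
maximal temperature. -/
lemma exists_bounds {M ε : ℝ} (hμ : 0 < μ) (hR : 0 < R) (hκ₁ : 0 < κ₁) (hκ₂ : 0 < κ₂)
    (hβ : 0 < β) (hγ : 1 < γ) (hM : 1 ≤ M) (hT : 0 < T) :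
    ∃ K c : ℝ, 0 < K ∧ 0 < c ∧ ∀ S : Sol μ R a b κ₁ κ₂ β γ T, S.Bounded M ε →
      ∀ t ∈ Icc (0 : ℝ) T, L2sq (S.u t) ≤ K ∧
        ∀ x ∈ Icc (-(1/2) : ℝ) (1/2), S.v t x ≤ c * (1 + S.Y t ^ (1 / (2 * β + 3))) := by
  have hγ' : 0 < γ - 1 := by linarith
  set cv := R / (γ - 1) with hcv
  have hcv0 : 0 < cv := by positivity
  set E := cv * (1 + M ^ 2) + M ^ 2 / 2 with hE
  have hE0 : 0 < E := by positivity
  set D := ((E / cv) ^ (β + 3/2) + (β + 3/2) * (√(E / cv) * (1 / κ₂))) ^ (1 / (β + 3/2)) with hD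
  have hD0 : 0 ≤ D := by positivity
  refine ⟨2 * E, rexp (8 * (1 + 2 * E) / μ) * (2 + M ^ 2 + R / μ * T * D), by positivity,
    by positivity, fun S hS t ht => ?_⟩
  have hen : ∀ s ∈ Icc 0 T, cv * tInt (S.θ s) + L2sq (S.u s) / 2 ≤ E := fun s hs =>
    S.energy_le hR hγ hM hS hs
  have hu : ∀ s ∈ Icc 0 T, L2sq (S.u s) ≤ 2 * E := fun s hs => by
    have h1 : 0 ≤ cv * tInt (S.θ s) := mul_nonneg hcv0.le (tInt_nonneg fun x => (S.θ_pos s x).le)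
    linarith [hen s hs]
  have hθ : ∀ s ∈ Icc 0 T, tInt (S.θ s) ≤ E / cv := fun s hs => by
    rw [le_div_iff₀ hcv0]
    linarith [hen s hs, L2sq_nonneg (S.u s)]
  refine ⟨hu t ht, fun x hx => ?_⟩
  have hΘ : ∀ s ∈ Icc 0 t, ∀ x ∈ Icc (-(1/2) : ℝ) (1/2),
      S.θ s x ≤ D * (1 + S.Y t ^ (1 / (2 * β + 3))) := fun s hs x hx =>
    S.theta_le hκ₁ hκ₂ hβ (by positivity) (hθ s ⟨hs.1, hs.2.trans ht.2⟩) hs hx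
  refine (S.v_le hμ hR hu (fun x hx => S.v_zero_le hM hS hx) ht hΘ hx).trans ?_
  refine (mul_le_mul_of_nonneg_left ?_ (Real.exp_pos _).le).trans_eq (mul_assoc _ _ _).symm
  have hY : 0 ≤ S.Y t ^ (1 / (2 * β + 3)) := Real.rpow_nonneg (S.Y_nonneg t) _
  nlinarith [mul_nonneg (show (0:ℝ) ≤ 2 + M ^ 2 by positivity) hY]

end Sol

end RadHydro

theorem stmt_6 (μ R a b κ₁ κ₂ β γ : ℝ)
    (hμ : 0 < μ) (hR : 0 < R) (ha : 0 < a) (hb : 0 < b)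
    (hκ₁ : 0 < κ₁) (hκ₂ : 0 < κ₂) (hβ : 0 < β) (hγ : 1 < γ)
    (T M ε : ℝ) (hT : 0 < T) (hM : 1 ≤ M) (hε0 : 0 < ε) (hε1 : ε ≤ 1) :
    ∃ C : ℝ, 0 < C ∧
      ∀ S : Sol μ R a b κ₁ κ₂ β γ T, S.Bounded M ε →
        ∀ t ∈ Icc (0 : ℝ) T,
          Real.sqrt (L2sq (px S.u t)) ≤ C * (1 + S.Y t ^ (1 / (4 * β + 6))) * S.Z t ^ ((1:ℝ)/4) ∧
          Linf (px S.u t) ≤ C * (1 + S.Y t ^ (3 / (8 * β + 12))) * S.Z t ^ ((3:ℝ)/8) := by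
  obtain ⟨K, c, hK, hc, hbd⟩ := Sol.exists_bounds (a := a) (b := b) (ε := ε)
    hμ hR hκ₁ hκ₂ hβ hγ hM hT
  set c₃ := √(√K * c) with hc₃
  have hc₃0 : 0 < c₃ := by positivity
  refine ⟨c₃ + √(4 * c * c₃), by positivity, fun S hS t ht => ?_⟩
  obtain ⟨hu, hv⟩ := hbd S hS t ht
  have hY := S.Y_nonneg t
  have hZ := S.Z_nonneg t
  set w := S.Y t ^ (1 / (4 * β + 6)) with hw
  set z := S.Z t ^ ((1:ℝ)/4) with hz
  set Q := S.Y t ^ (3 / (8 * β + 12)) with hQ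
  set N := S.Z t ^ ((3:ℝ)/8) with hN
  have hw0 : 0 ≤ w := Real.rpow_nonneg hY _
  have hz0 : 0 ≤ z := Real.rpow_nonneg hZ _
  have hQ0 : 0 ≤ Q := Real.rpow_nonneg hY _
  have hN0 : 0 ≤ N := Real.rpow_nonneg hZ _
  have hw2 : S.Y t ^ (1 / (2 * β + 3)) = w ^ 2 := by
    rw [hw, ← Real.rpow_mul_natCast hY]
    congr 1; push_cast; field_simp; ring
  have hz2 : √(S.Z t) = z ^ 2 := by
    rw [hz, ← Real.rpow_mul_natCast hZ, Real.sqrt_eq_rpow]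
    norm_num
  have hQ2 : Q ^ 2 = w ^ 3 := by
    rw [hw, hQ, ← Real.rpow_mul_natCast hY, ← Real.rpow_mul_natCast hY]
    congr 1; push_cast; field_simp; ring
  have hN2 : N ^ 2 = z ^ 3 := by
    rw [hz, hN, ← Real.rpow_mul_natCast hZ, ← Real.rpow_mul_natCast hZ]
    norm_num
  rw [hw2] at hv
  have hxx := S.sqrt_L2sq_px_px_u_le hv ht.1
  rw [hz2] at hxx
  have hL : √(L2sq (px S.u t)) ≤ c₃ * (1 + w) * z := by
    refine Real.sqrt_le_iff.2 ⟨by positivity, (S.L2sq_px_u_le t).trans ?_⟩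
    have hc₃2 : c₃ ^ 2 = √K * c := Real.sq_sqrt (by positivity)
    calc √(L2sq (S.u t)) * √(L2sq (px (px S.u) t))
        ≤ √K * (c * (1 + w ^ 2) * z ^ 2) :=
          mul_le_mul (Real.sqrt_le_sqrt hu) hxx (Real.sqrt_nonneg _) (Real.sqrt_nonneg _)
      _ = c₃ ^ 2 * z ^ 2 * (1 + w ^ 2) := by rw [hc₃2]; ring
      _ ≤ c₃ ^ 2 * z ^ 2 * (1 + w) ^ 2 :=
          mul_le_mul_of_nonneg_left (by nlinarith) (by positivity)
      _ = (c₃ * (1 + w) * z) ^ 2 := by ring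
  refine ⟨hL.trans ?_, ?_⟩
  · gcongr
    exact le_add_of_nonneg_right (Real.sqrt_nonneg _)
  · refine csSup_le ((nonempty_Icc.2 (by norm_num)).image _) ?_
    rintro _ ⟨x, hx, rfl⟩
    have h1 : px S.u t x ^ 2 ≤ (√(4 * c * c₃) * (1 + Q) * N) ^ 2 := by
      calc px S.u t x ^ 2 ≤ 2 * (√(L2sq (px S.u t)) * √(L2sq (px (px S.u) t))) :=
            S.px_u_sq_le hx
        _ ≤ 2 * ((c₃ * (1 + w) * z) * (c * (1 + w ^ 2) * z ^ 2)) :=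
            mul_le_mul_of_nonneg_left
              (mul_le_mul hL hxx (Real.sqrt_nonneg _) (by positivity)) zero_le_two
        _ = 2 * c * c₃ * z ^ 3 * ((1 + w) * (1 + w ^ 2)) := by ring
        _ ≤ 2 * c * c₃ * z ^ 3 * (2 * (1 + w ^ 3)) :=
            mul_le_mul_of_nonneg_left
              (by nlinarith [mul_nonneg (add_nonneg zero_le_one hw0) (sq_nonneg (1 - w))])
              (by positivity)
        _ = 4 * c * c₃ * N ^ 2 * (1 + Q ^ 2) := by rw [hN2, hQ2]; ring
        _ ≤ 4 * c * c₃ * N ^ 2 * (1 + Q) ^ 2 :=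
            mul_le_mul_of_nonneg_left (by nlinarith) (by positivity)
        _ = (√(4 * c * c₃) * (1 + Q) * N) ^ 2 := by
            rw [mul_pow, mul_pow, Real.sq_sqrt (by positivity)]; ring
    refine (abs_le_of_sq_le_sq h1 (by positivity)).trans ?_
    gcongr
    exact le_add_of_nonneg_left hc₃0.le
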